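/- Let A be a unital C*-algebra, θ ∈ (0,1) an irrational number, and u, v ∈ A unitary elements satisfying vu = e^{2πiθ}uv, such that the spectrum of u*v equals the full unit circle 𝕋. Then for every real λ > 1, the spectrum of u + λv equals λ𝕋 = {z ∈ ℂ : |z| = λ}. -/

import Mathlib

/-- If `p` is not a root of unity and `1 < lam`, then `x ↦ log (1 + x / lam)` is, on the unit circle,
uniformly approximated by continuous coboundaries for the rotation by `p`. -/
theorem exists_continuous_coboundary_approx {lam : ℝ} (h1 : 1 < lam) {p : ℂ}
    (hp : ∀ k : ℕ, k ≠ 0 → p ^ k ≠ 1) {δ : ℝ} (hδ : 0 < δ) :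
    ∃ G : ℂ → ℂ, Continuous G ∧ ∀ x : ℂ, ‖x‖ = 1 →
      ‖Complex.log (1 + x / lam) - (G (p * x) - G x)‖ ≤ δ := by
  have h0 : 0 < lam := by linarith
  have hs0 : 0 < lam⁻¹ := inv_pos.2 h0
  have hs1 : lam⁻¹ < 1 := inv_lt_one_of_one_lt₀ h1
  obtain ⟨n, hn⟩ := exists_pow_lt_of_lt_one (mul_pos hδ (sub_pos.2 hs1)) hs1
  refine ⟨fun x => ∑ j ∈ Finset.range (n + 1),
    ((-1) ^ (j + 1) * (x / lam) ^ j / j) / (p ^ j - 1), by fun_prop, fun x hx => ?_⟩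
  have hcob : (∑ j ∈ Finset.range (n + 1),
        ((-1) ^ (j + 1) * (p * x / lam) ^ j / j) / (p ^ j - 1)) -
      (∑ j ∈ Finset.range (n + 1), ((-1) ^ (j + 1) * (x / lam) ^ j / j) / (p ^ j - 1)) =
      Complex.logTaylor (n + 1) (x / lam) := by
    rw [Complex.logTaylor, ← Finset.sum_sub_distrib]
    refine Finset.sum_congr rfl fun j _ => ?_
    rcases eq_or_ne j 0 with rfl | hj
    · simp
    · have := sub_ne_zero.2 (hp j hj)
      rw [mul_div_assoc p, mul_pow]
      field_simp
  have hnorm : ‖x / (lam : ℂ)‖ = lam⁻¹ := by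
    rw [norm_div, hx, Complex.norm_real, Real.norm_of_nonneg h0.le, one_div]
  have hlog := Complex.norm_log_sub_logTaylor_le n (z := x / lam) (hnorm.trans_lt hs1)
  dsimp only
  rw [hcob]
  refine hlog.trans ?_
  rw [hnorm]
  have hpos : 0 < 1 - lam⁻¹ := sub_pos.2 hs1
  refine (div_le_self (by positivity) (by linarith [n.cast_nonneg (α := ℝ)])).trans ?_
  rw [← div_eq_mul_inv, div_le_iff₀ hpos, pow_succ]
  exact (mul_le_of_le_one_right (by positivity) hs1.le).trans hn.le

/-- Continuous functional calculus intertwines with a unitary implementing a rotation. -/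
theorem cfc_mul_unitary_of_rotation {A : Type*} [CStarAlgebra A] {v z : A} (hv : v ∈ unitary A)
    [IsStarNormal z] {p : ℂ} (hvz : z * v = p • (v * z)) {f : ℂ → ℂ} (hf : Continuous f) :
    cfc f z * v = v * cfc (fun x => f (p * x)) z := by
  have hz : Unitary.conjStarAlgAut ℂ A ⟨v, hv⟩ (p • z) = z := by
    rw [Unitary.conjStarAlgAut_apply]
    simp only [mul_smul_comm, smul_mul_assoc]
    rw [← smul_mul_assoc, ← hvz, mul_assoc, Unitary.mul_star_self_of_mem hv, mul_one]
  have hcont : Continuous (Unitary.conjStarAlgAut ℂ A ⟨v, hv⟩) := by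
    have : ⇑(Unitary.conjStarAlgAut ℂ A ⟨v, hv⟩) = fun x => v * x * star v :=
      funext fun x => Unitary.conjStarAlgAut_apply _ x
    rw [this]
    fun_prop
  have hpz : IsStarNormal (p • z) := inferInstance
  have key := StarAlgHomClass.map_cfc (S := ℂ) (Unitary.conjStarAlgAut ℂ A ⟨v, hv⟩) f (p • z)
    hf.continuousOn hcont hpz (by rw [hz]; infer_instance)
  rw [hz, Unitary.conjStarAlgAut_apply, ← cfc_comp_const_mul p f z hf.continuousOn] at key
  rw [← key, mul_assoc, Unitary.star_mul_self_of_mem hv, mul_one]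

/-- Elements of the spectrum of `u + lam • v` have modulus close to `lam`. -/
theorem norm_le_and_le_norm_of_mem_spectrum {A : Type*} [CStarAlgebra A] [Nontrivial A] {u v : A}
    (hu : u ∈ unitary A) (hv : v ∈ unitary A) {q : ℂ} (hq0 : q ≠ 0)
    (hq : ∀ k : ℕ, k ≠ 0 → q ^ k ≠ 1) (hrel : v * u = q • (u * v))
    {lam : ℝ} (h1 : 1 < lam) {δ : ℝ} (hδ : 0 < δ) {k : ℂ}
    (hk : k ∈ spectrum ℂ (u + (lam : ℂ) • v)) :
    ‖k‖ ≤ lam * Real.exp δ ∧ lam ≤ ‖k‖ * Real.exp δ := by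
  have h0 : 0 < lam := by linarith
  have hlam : (lam : ℂ) ≠ 0 := by exact_mod_cast h0.ne'
  obtain ⟨G, hG, hGδ⟩ := exists_continuous_coboundary_approx h1 (p := q⁻¹)
    (fun k hk h => hq k hk (by simpa using h)) hδ
  set z : A := star v * u with hz
  have hzu : z ∈ unitary A := mul_mem (Unitary.star_mem hv) hu
  have : IsStarNormal z := ⟨by
    rw [commute_iff_eq, Unitary.star_mul_self_of_mem hzu, Unitary.mul_star_self_of_mem hzu]⟩
  have hvz : z * v = q⁻¹ • (v * z) := by
    rw [hz, ← mul_assoc v, Unitary.mul_star_self_of_mem hv, one_mul, mul_assoc,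
      eq_inv_smul_iff₀ hq0, ← mul_smul_comm, ← hrel, ← mul_assoc,
      Unitary.star_mul_self_of_mem hv, one_mul]
  have hspec : ∀ x ∈ spectrum ℂ z, ‖x‖ = 1 := fun x hx => by
    simpa using spectrum.subset_circle_of_unitary hzu hx
  have hne : ∀ x : ℂ, ‖x‖ = 1 → 1 + x / lam ≠ 0 := fun x hx h => by
    have hx' : x = -lam := by
      field_simp at h
      linear_combination h
    rw [hx', norm_neg, Complex.norm_real, Real.norm_of_nonneg h0.le] at hx
    linarith
  set f : ℂ → ℂ := fun x => Complex.exp (G x) with hf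
  set r : ℂ → ℂ := fun x => Complex.exp (-G (q⁻¹ * x)) * (1 + x / lam) * Complex.exp (G x) with hr
  have hfc : Continuous f := by fun_prop
  have hrc : Continuous r := by fun_prop
  have hrexp : ∀ x, ‖x‖ = 1 → r x =
      Complex.exp (Complex.log (1 + x / lam) - (G (q⁻¹ * x) - G x)) := fun x hx => by
    rw [hr, show Complex.log (1 + x / lam) - (G (q⁻¹ * x) - G x) =
      -G (q⁻¹ * x) + Complex.log (1 + x / lam) + G x by ring, Complex.exp_add, Complex.exp_add,
      Complex.exp_log (hne x hx)]
  have hr0 : ∀ x ∈ spectrum ℂ z, r x ≠ 0 := fun x hx => by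
    rw [hrexp x (hspec x hx)]
    exact Complex.exp_ne_zero _
  let F : Aˣ := cfcUnits f z (fun x _ => Complex.exp_ne_zero _) hfc.continuousOn
  let R : Aˣ := cfcUnits r z hr0 hrc.continuousOn
  let V : Aˣ := Unitary.toUnits ⟨v, hv⟩
  let B : Aˣ := Units.mk0 (lam : ℂ) hlam • (V * R)
  have hB : (B : A) = (lam : ℂ) • (v * cfc r z) := rfl
  have hBinv : ((B⁻¹ : Aˣ) : A) = (lam : ℂ)⁻¹ • (cfc (fun x => (r x)⁻¹) z * star v) := by
    refine Units.inv_eq_of_mul_eq_one_right ?_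
    have hRR : cfc r z * cfc (fun x => (r x)⁻¹) z = 1 := R.mul_inv
    rw [hB, smul_mul_smul_comm, mul_inv_cancel₀ hlam, one_smul, mul_assoc,
      ← mul_assoc (cfc r z), hRR, one_mul, Unitary.mul_star_self_of_mem hv]
  have hone : (u + (lam : ℂ) • v) = (lam : ℂ) • (v * cfc (fun x : ℂ => 1 + x / lam) z) := by
    have : cfc (fun x : ℂ => 1 + x / lam) z = 1 + (lam : ℂ)⁻¹ • z := by
      rw [cfc_const_add (1 : ℂ) (fun x : ℂ => x / lam) z (by fun_prop), map_one]
      congr 1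
      simp_rw [div_eq_inv_mul]
      exact cfc_const_mul_id _ z
    rw [this, mul_add, mul_one, mul_smul_comm, smul_add, smul_smul, mul_inv_cancel₀ hlam, one_smul,
      hz, ← mul_assoc, Unitary.mul_star_self_of_mem hv, one_mul, add_comm]
  have hconj : u + (lam : ℂ) • v = F * B * (F⁻¹ : Aˣ) := by
    rw [Units.eq_mul_inv_iff_mul_eq, hone, hB]
    change (lam : ℂ) • (v * cfc (fun x : ℂ => 1 + x / lam) z) * cfc f z =
      cfc f z * (lam : ℂ) • (v * cfc r z)
    rw [mul_smul_comm, smul_mul_assoc, ← mul_assoc (cfc f z), cfc_mul_unitary_of_rotation hv hvz hfc,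
      mul_assoc, mul_assoc, ← cfc_mul _ _ z (by fun_prop) (by fun_prop),
      ← cfc_mul _ _ z (by fun_prop) (by fun_prop)]
    congr 3
    funext x
    simp only [hf, hr, Complex.exp_neg]
    have := Complex.exp_ne_zero (G (q⁻¹ * x))
    field_simp
  rw [hconj, spectrum.units_conjugate] at hk
  have hnv : ‖v‖ = 1 := CStarRing.norm_of_mem_unitary hv
  have hR : ‖cfc r z‖ ≤ Real.exp δ := norm_cfc_le (Real.exp_pos _).le fun x hx => by
    rw [hrexp x (hspec x hx)]
    exact (Complex.norm_exp_le_exp_norm _).trans (Real.exp_le_exp.2 (hGδ x (hspec x hx)))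
  have hR' : ‖cfc (fun x => (r x)⁻¹) z‖ ≤ Real.exp δ := norm_cfc_le (Real.exp_pos _).le fun x hx => by
    rw [hrexp x (hspec x hx), ← Complex.exp_neg]
    refine (Complex.norm_exp_le_exp_norm _).trans (Real.exp_le_exp.2 ?_)
    rw [norm_neg]
    exact hGδ x (hspec x hx)
  constructor
  · refine (spectrum.norm_le_norm_of_mem hk).trans ?_
    rw [hB, norm_smul, Complex.norm_real, Real.norm_of_nonneg h0.le]
    gcongr
    refine (norm_mul_le _ _).trans ?_
    rwa [hnv, one_mul]
  · have hk0 : k ≠ 0 := spectrum.ne_zero_of_mem_of_unit hk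
    have hinv := spectrum.norm_le_norm_of_mem (spectrum.inv₀_mem_inv_iff.2 hk)
    rw [hBinv, norm_smul, norm_inv, norm_inv, Complex.norm_real, Real.norm_of_nonneg h0.le] at hinv
    have hle : ‖k‖⁻¹ ≤ lam⁻¹ * Real.exp δ := by
      refine hinv.trans ?_
      gcongr
      refine (norm_mul_le _ _).trans ?_
      rwa [norm_star, hnv, mul_one]
    have hkp : 0 < ‖k‖ := norm_pos_iff.2 hk0
    rw [inv_le_iff_one_le_mul₀ hkp, inv_mul_eq_div, div_mul_eq_mul_div, le_div_iff₀ h0] at hle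
    linarith

/-- The spectrum of `u + c • v` is invariant under rotation by `q` when `v * u = q • (u * v)`. -/
theorem mul_mem_spectrum_iff_of_commutation {A : Type*} [CStarAlgebra A] {u v : A}
    (hu : u ∈ unitary A) (hv : v ∈ unitary A) {q : ℂ} (hq0 : q ≠ 0) (hrel : v * u = q • (u * v))
    (c k : ℂ) : q * k ∈ spectrum ℂ (u + c • v) ↔ k ∈ spectrum ℂ (u + c • v) := by
  let w : Aˣ := Unitary.toUnits ⟨star u * v, mul_mem (Unitary.star_mem hu) hv⟩
  have hw : (w : A) = star u * v := rfl
  have hconj : (w : A) * (u + c • v) * (w⁻¹ : Aˣ) = Units.mk0 q hq0 • (u + c • v) := by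
    rw [Units.mul_inv_eq_iff_eq_mul, hw]
    change star u * v * (u + c • v) = q • (u + c • v) * (star u * v)
    have e1 : star u * v * u = q • v := by
      rw [mul_assoc, hrel, mul_smul_comm, ← mul_assoc, Unitary.star_mul_self_of_mem hu, one_mul]
    have e2 : u * (star u * v) = v := by
      rw [← mul_assoc, Unitary.mul_star_self_of_mem hu, one_mul]
    have e3 : q • (v * (star u * v)) = star u * v * v := by
      calc q • (v * (star u * v)) = (q • v) * (star u * v) := (smul_mul_assoc _ _ _).symm
        _ = star u * v * (u * (star u * v)) := by rw [← e1, mul_assoc (star u * v)]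
        _ = star u * v * v := by rw [e2]
    rw [mul_add, e1, mul_smul_comm, smul_mul_assoc, add_mul, e2, smul_add, smul_mul_assoc,
      smul_comm q c, e3]
  have h := spectrum.units_conjugate (R := ℂ) (a := u + c • v) (u := w)
  rw [hconj, spectrum.unit_smul_eq_smul] at h
  conv_lhs => rw [← h]
  exact Set.smul_mem_smul_set_iff (a := Units.mk0 q hq0)

/-- A nonempty closed subset of a circle about `0` that is invariant under an irrational rotation
is the whole circle. -/
theorem eq_sphere_of_irrational_rotation {S : Set ℂ} (hS : IsClosed S) (hne : S.Nonempty)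
    {lam : ℝ} (hsub : S ⊆ Metric.sphere 0 lam) {θ : ℝ} (hθ : Irrational θ)
    (hrot : ∀ k, Complex.exp (2 * Real.pi * Complex.I * θ) * k ∈ S ↔ k ∈ S) :
    S = Metric.sphere 0 lam := by
  refine hsub.antisymm fun y hy => ?_
  obtain ⟨x, hx⟩ := hne
  let e : ℝ → ℂ := fun t => Complex.exp (2 * Real.pi * Complex.I * t)
  have eadd : ∀ s t, e (s + t) = e s * e t := fun s t => by
    simp only [e]
    rw [← Complex.exp_add]
    push_cast
    ring_nf
  have e1 : e 1 = 1 := by simp [e, Complex.exp_two_pi_mul_I]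
  have e0 : e 0 = 1 := by simp [e]
  let H : AddSubgroup ℝ :=
    { carrier := {t | ∀ k, e t * k ∈ S ↔ k ∈ S}
      zero_mem' := fun k => by rw [e0, one_mul]
      add_mem' := fun {s t} hs ht k => by rw [eadd, mul_assoc, hs, ht]
      neg_mem' := fun {t} ht k => by
        rw [← ht, ← mul_assoc, ← eadd, add_neg_cancel, e0, one_mul] }
  have hH : AddSubgroup.closure {θ, 1} ≤ H := by
    rw [AddSubgroup.closure_le]
    rintro t (rfl | rfl)
    · exact hrot
    · exact fun k => by rw [e1, one_mul]
  have hdense : Dense (AddSubgroup.closure {θ, 1} : Set ℝ) :=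
    dense_addSubgroupClosure_pair_iff.2 (by rwa [div_one])
  have hall : ∀ t, e t * x ∈ S := fun t => by
    have hcl : IsClosed {t | e t * x ∈ S} := hS.preimage (by fun_prop)
    have : closure (AddSubgroup.closure {θ, 1} : Set ℝ) ⊆ {t | e t * x ∈ S} :=
      hcl.closure_subset_iff.2 fun t ht => (hH ht x).2 hx
    exact this (hdense t)
  have hxn : ‖x‖ = lam := by simpa using hsub hx
  have hyn : ‖y‖ = lam := by simpa using hy
  have hxe : (lam : ℂ) * Complex.exp (x.arg * Complex.I) = x := by
    rw [← hxn]; exact Complex.norm_mul_exp_arg_mul_I x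
  have hye : (lam : ℂ) * Complex.exp (y.arg * Complex.I) = y := by
    rw [← hyn]; exact Complex.norm_mul_exp_arg_mul_I y
  have h := hall ((y.arg - x.arg) / (2 * Real.pi))
  have harg : e ((y.arg - x.arg) / (2 * Real.pi)) * Complex.exp (x.arg * Complex.I) =
      Complex.exp (y.arg * Complex.I) := by
    rw [← Complex.exp_add]
    congr 1
    have := Real.pi_ne_zero
    push_cast
    field_simp
    ring
  rwa [← hye, ← harg, mul_left_comm, hxe]


/-- Let A be a unital C*-algebra, θ ∈ (0,1) irrational, u, v ∈ A unitaries
with vu = e^{2πiθ}uv and σ(u*v) = 𝕋.  Then for every real λ > 1, the spectrum of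
u + λv equals λ𝕋 = {z : |z| = λ}. -/
theorem stmt_15 {A : Type*} [NormedRing A] [StarRing A] [CStarRing A] [CompleteSpace A]
    [NormedAlgebra ℂ A] [StarModule ℂ A]
    (θ : ℝ) (hθ : θ ∈ Set.Ioo (0 : ℝ) 1) (hirr : Irrational θ)
    (u v : A) (hu : u ∈ unitary A) (hv : v ∈ unitary A)
    (hrel : v * u = Complex.exp (2 * Real.pi * Complex.I * θ) • (u * v))
    (hspec : spectrum ℂ (star u * v) = Metric.sphere (0 : ℂ) 1)
    (lam : ℝ) (h1 : 1 < lam) :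
    spectrum ℂ (u + (lam : ℂ) • v) = Metric.sphere (0 : ℂ) lam := by
  let _ : CStarAlgebra A := CStarAlgebra.mk
  have hA : Nontrivial A := by
    by_contra h
    rw [not_nontrivial_iff_subsingleton] at h
    have hmem : (1 : ℂ) ∈ spectrum ℂ (star u * v) := by rw [hspec]; simp
    simp [spectrum.of_subsingleton] at hmem
  set q := Complex.exp (2 * Real.pi * Complex.I * θ) with hqdef
  have hq0 : q ≠ 0 := Complex.exp_ne_zero _
  have hq : ∀ k : ℕ, k ≠ 0 → q ^ k ≠ 1 := fun k hk h => by
    rw [hqdef, ← Complex.exp_nat_mul, Complex.exp_eq_one_iff] at h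
    obtain ⟨n, hn⟩ := h
    have h2 : (k : ℂ) * θ = n := mul_right_cancel₀ Complex.two_pi_I_ne_zero (by
      linear_combination hn)
    have h3 : (k : ℝ) * θ = n := by exact_mod_cast h2
    exact (hirr.natCast_mul hk).ne_int n h3
  refine eq_sphere_of_irrational_rotation (spectrum.isClosed _) (spectrum.nonempty _) ?_ hirr
    (mul_mem_spectrum_iff_of_commutation hu hv hq0 hrel _)
  intro k hk
  have hb := fun δ (hδ : 0 < δ) => norm_le_and_le_norm_of_mem_spectrum hu hv hq0 hq hrel h1 hδ hk
  have hlim : ∀ c : ℝ, Filter.Tendsto (fun δ => c * Real.exp δ) (nhdsWithin 0 (Set.Ioi 0))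
      (nhds c) := fun c => by
    have : Continuous fun δ => c * Real.exp δ := by fun_prop
    simpa using (this.tendsto 0).mono_left nhdsWithin_le_nhds
  rw [mem_sphere_zero_iff_norm]
  exact le_antisymm
    (ge_of_tendsto (hlim lam) (eventually_mem_nhdsWithin.mono fun δ hδ => (hb δ hδ).1))
    (ge_of_tendsto (hlim ‖k‖) (eventually_mem_nhdsWithin.mono fun δ hδ => (hb δ hδ).2))
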